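/- arXiv:2510.05766 — 2 statements merged into one kernel-verified Lean document; each statement's English description precedes it below -/
import Mathlib

section
/- Let M = D1·M1·D2 where D1, D2 are nonsingular diagonal matrices over a field. If M is semi-involutory with corresponding diagonal matrices D and D' (i.e., M⁻¹ = D·M·D'), then M1 is semi-involutory, with M1⁻¹ = (D2·D·D1)·M1·(D2·D'·D1). Conversely, if M1 is semi-involutory then M is semi-involutory. -/
theorem Matrix.inv_diagonal_of_ne_zero {F ι : Type*} [Field F] [Fintype ι] [DecidableEq ι]
    (d : ι → F) (hd : ∀ i, d i ≠ 0) :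
    (Matrix.diagonal d)⁻¹ = Matrix.diagonal (fun i => (d i)⁻¹) := by
  apply Matrix.inv_eq_left_inv
  simp [Matrix.diagonal_mul_diagonal, hd]

theorem Matrix.isUnit_det_diagonal {F ι : Type*} [Field F] [Fintype ι] [DecidableEq ι]
    (d : ι → F) (hd : ∀ i, d i ≠ 0) : IsUnit (Matrix.diagonal d).det := by
  simp [Matrix.det_diagonal, Finset.prod_ne_zero_iff, hd]


/-- Let `M = D1 * M1 * D2` with `D1`, `D2` nonsingular diagonal. If `M` is semi-involutory
with corresponding diagonal matrices `D`, `D'` then `M1⁻¹ = (D2*D*D1) * M1 * (D2*D'*D1)`;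
conversely if `M1` is semi-involutory then so is `M`. -/
theorem stmt_5 {F : Type*} [Field F] {n : ℕ}
    (M1 : Matrix (Fin n) (Fin n) F) (hM1 : IsUnit M1.det)
    (d1 d2 : Fin n → F) (h1 : ∀ i, d1 i ≠ 0) (h2 : ∀ i, d2 i ≠ 0) :
    (∀ d d' : Fin n → F, (∀ i, d i ≠ 0) → (∀ i, d' i ≠ 0) →
      (Matrix.diagonal d1 * M1 * Matrix.diagonal d2)⁻¹ =
        Matrix.diagonal d * (Matrix.diagonal d1 * M1 * Matrix.diagonal d2) * Matrix.diagonal d' →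
      M1⁻¹ = (Matrix.diagonal d2 * Matrix.diagonal d * Matrix.diagonal d1) * M1 *
        (Matrix.diagonal d2 * Matrix.diagonal d' * Matrix.diagonal d1)) ∧
    ((∃ e e' : Fin n → F, (∀ i, e i ≠ 0) ∧ (∀ i, e' i ≠ 0) ∧
        M1⁻¹ = Matrix.diagonal e * M1 * Matrix.diagonal e') →
      ∃ e e' : Fin n → F, (∀ i, e i ≠ 0) ∧ (∀ i, e' i ≠ 0) ∧
        (Matrix.diagonal d1 * M1 * Matrix.diagonal d2)⁻¹ =
          Matrix.diagonal e * (Matrix.diagonal d1 * M1 * Matrix.diagonal d2) *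
            Matrix.diagonal e') := by
  constructor
  · intro d d' _ _ h
    have hu1 := Matrix.isUnit_det_diagonal d1 h1
    have hu2 := Matrix.isUnit_det_diagonal d2 h2
    calc M1⁻¹ = Matrix.diagonal d2 * (Matrix.diagonal d1 * M1 * Matrix.diagonal d2)⁻¹ *
          Matrix.diagonal d1 := by
          rw [Matrix.mul_inv_rev, Matrix.mul_inv_rev, ← Matrix.mul_assoc,
            Matrix.mul_nonsing_inv _ hu2, Matrix.one_mul, Matrix.mul_assoc,
            Matrix.nonsing_inv_mul _ hu1, Matrix.mul_one]
      _ = _ := by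
          rw [h]
          simp only [Matrix.mul_assoc]
  · rintro ⟨e, e', he, he', h⟩
    refine ⟨fun i => (d2 i)⁻¹ * e i * (d1 i)⁻¹, fun i => (d2 i)⁻¹ * e' i * (d1 i)⁻¹,
      fun i => by simp [h1, h2, he], fun i => by simp [h1, h2, he'], ?_⟩
    rw [Matrix.mul_inv_rev, Matrix.mul_inv_rev, h, Matrix.inv_diagonal_of_ne_zero d1 h1,
      Matrix.inv_diagonal_of_ne_zero d2 h2]
    ext i j
    have := h1 i
    have := h2 j
    simp only [Matrix.diagonal_mul, Matrix.mul_diagonal]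
    field_simp
end

section
/- For a finite field F_{2^m} with m ≥ 3, the number of quadruples (m_11, m_12, m_21, m_22) ∈ F_{2^m}^4 satisfying m_11·m_22 + m_12·m_21 + m_11 + m_12 + m_21 + m_22 = 1, with m_11, m_12, m_21, m_22 all nonzero, m_12 ≠ m_11 + 1, m_21 ≠ m_11 + 1, m_22 ≠ m_12 + 1, m_22 ≠ m_21 + 1, and m_22 ≠ m_11 + m_12 + m_21 + 1, is exactly (2^m − 2)(2^m − 3)(2^m − 4). -/
open Finset

section

variable {F : Type*} [Field F]

/-- The `2 × 2` matrices `!![x, y; z, w]` of determinant one (in characteristic two) on which no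
form `u ᵥ* M ⬝ᵥ v`, with `u` and `v` nonzero `0/1` vectors, takes the value one. -/
def IsUnitAvoiding (x y z w : F) : Prop :=
  x * w + y * z = 1 ∧ (x ≠ 1 ∧ y ≠ 1 ∧ x + y ≠ 1) ∧ (z ≠ 1 ∧ x + z ≠ 1) ∧
    (w ≠ 1 ∧ y + w ≠ 1) ∧ (z + w ≠ 1 ∧ x + y + z + w ≠ 1)

theorem eq_iff_eq_of_mul_sub_eq {a b p q r s : F} (ha : a ≠ 0) (hb : b ≠ 0)
    (h : a * (p - q) = b * (r - s)) : p = q ↔ r = s := by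
  rw [← sub_eq_zero, ← mul_eq_zero_iff_left ha, h, mul_eq_zero_iff_left hb, sub_eq_zero]

section SecondRows

variable [Fintype F]

open scoped Classical in
/-- The possible second rows for a given first row `(x, y)`. -/
noncomputable def secondRows (x y : F) : Finset (F × F) :=
  {p | IsUnitAvoiding x y p.1 p.2}

theorem mem_secondRows {x y : F} {p : F × F} :
    p ∈ secondRows x y ↔ IsUnitAvoiding x y p.1 p.2 := by
  simp [secondRows]

theorem secondRows_eq_empty {x y : F} (h : x = 1 ∨ y = 1 ∨ x + y = 1) : secondRows x y = ∅ := by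
  ext p
  simp only [mem_secondRows, IsUnitAvoiding, notMem_empty, iff_false]
  tauto

end SecondRows

variable [CharP F 2]

theorem isUnitAvoiding_add_one (a b c d : F) :
    IsUnitAvoiding (a + 1) (b + 1) (c + 1) (d + 1) ↔
      a * d + b * c + a + b + c + d = 1 ∧
        a ≠ 0 ∧ b ≠ 0 ∧ c ≠ 0 ∧ d ≠ 0 ∧ b ≠ a + 1 ∧ c ≠ a + 1 ∧
        d ≠ b + 1 ∧ d ≠ c + 1 ∧ d ≠ a + b + c + 1 := by
  have h2 : (2 : F) = 0 := CharTwo.two_eq_zero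
  have hdet : (a + 1) * (d + 1) + (b + 1) * (c + 1) = 1 ↔
      a * d + b * c + a + b + c + d = 1 := by grind
  have hpair (x y : F) : x + 1 + (y + 1) = 1 ↔ y = x + 1 := by grind
  have hall : a + 1 + (b + 1) + (c + 1) + (d + 1) = 1 ↔ d = a + b + c + 1 := by grind
  simp only [IsUnitAvoiding, hdet, hpair, hall, ne_eq, add_eq_right]
  tauto

variable [DecidableEq F]

theorem card_translates_of_one {x u : F} (hu : x * u = 1) (h1 : x ≠ 1) :
    #({1, 1 + x, 1 + u, 1 + x + u} : Finset F) = 4 := by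
  have h2 : (2 : F) = 0 := CharTwo.two_eq_zero
  have hxu : x ≠ u := by
    rintro rfl
    have : (x - 1) ^ 2 = 0 := by linear_combination hu + (1 - x) * h2
    exact h1 (sub_eq_zero.mp (pow_eq_zero_iff two_ne_zero |>.mp this))
  rw [card_insert_of_notMem, card_insert_of_notMem, card_insert_of_notMem, card_singleton]
  all_goals simp only [mem_insert, mem_singleton]; grind

theorem card_translates_three {x u v : F} (hx0 : x ≠ 0) (hu : u ≠ 1) (hux : u ≠ 1 + x)
    (hv : v ≠ 1) (hvx : v ≠ 1 + x) (huv : u ≠ v) (huvx : u ≠ v + x) :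
    #({1, 1 + x, u, u + x, v, v + x} : Finset F) = 6 := by
  have h2 : (2 : F) = 0 := CharTwo.two_eq_zero
  rw [card_insert_of_notMem, card_insert_of_notMem, card_insert_of_notMem,
    card_insert_of_notMem, card_insert_of_notMem, card_singleton]
  all_goals simp only [mem_insert, mem_singleton]; grind

variable [Fintype F]

theorem card_secondRows_zero_left {y : F} (h0 : y ≠ 0) (h1 : y ≠ 1) :
    #(secondRows 0 y) = Fintype.card F - 4 := by
  have h2 : (2 : F) = 0 := CharTwo.two_eq_zero
  obtain ⟨z, hz⟩ : ∃ z, y * z = 1 := ⟨y⁻¹, mul_inv_cancel₀ h0⟩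
  have himage : secondRows 0 y = ({1, 1 + y, 1 + z, 1 + y + z}ᶜ : Finset F).image (z, ·) := by
    ext ⟨a, b⟩
    simp only [mem_secondRows, IsUnitAvoiding, mem_image, mem_compl, mem_insert, mem_singleton,
      Prod.mk.injEq, existsAndEq, and_true]
    grind
  rw [himage, card_image_of_injective _ (Prod.mk_right_injective z), card_compl,
    card_translates_of_one hz h1]

theorem card_secondRows_of_ne_zero {x y : F} (h0 : x ≠ 0) (s : Finset F)
    (hs : ∀ z w, x * w + y * z = 1 → (z ∉ s ↔ IsUnitAvoiding x y z w)) :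
    #(secondRows x y) = Fintype.card F - #s := by
  have h2 : (2 : F) = 0 := CharTwo.two_eq_zero
  rw [← card_compl]
  refine card_nbij' Prod.fst (fun z ↦ (z, (1 + y * z) / x)) ?_ ?_ ?_ ?_
  · rintro ⟨z, w⟩ h
    rw [mem_coe, mem_secondRows] at h
    rw [mem_coe, mem_compl]
    exact (hs z w h.1).2 h
  · intro z h
    rw [mem_coe, mem_compl] at h
    rw [mem_coe, mem_secondRows]
    refine (hs z _ ?_).1 h
    field_simp
    linear_combination (y * z) * h2
  · rintro ⟨z, w⟩ h
    rw [mem_coe, mem_secondRows] at h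
    refine Prod.ext rfl ?_
    rw [div_eq_iff h0]
    linear_combination (y * z) * h2 - h.1
  · intro z _
    rfl

theorem card_secondRows_zero_right {x : F} (h0 : x ≠ 0) (h1 : x ≠ 1) :
    #(secondRows x 0) = Fintype.card F - 4 := by
  have h2 : (2 : F) = 0 := CharTwo.two_eq_zero
  obtain ⟨u, hu⟩ : ∃ u, x * u = 1 := ⟨x⁻¹, mul_inv_cancel₀ h0⟩
  rw [card_secondRows_of_ne_zero h0 {1, 1 + x, 1 + u, 1 + x + u}, card_translates_of_one hu h1]
  intro z w h
  have hw : w = u := mul_left_cancel₀ h0 (by linear_combination h - hu)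
  subst hw
  simp only [IsUnitAvoiding, mem_insert, mem_singleton]
  grind

theorem card_secondRows_self {x : F} (h0 : x ≠ 0) (h1 : x ≠ 1) :
    #(secondRows x x) = Fintype.card F - 4 := by
  have h2 : (2 : F) = 0 := CharTwo.two_eq_zero
  obtain ⟨u, hu⟩ : ∃ u, x * u = 1 := ⟨x⁻¹, mul_inv_cancel₀ h0⟩
  rw [card_secondRows_of_ne_zero h0 {1, 1 + x, 1 + u, 1 + x + u}, card_translates_of_one hu h1]
  intro z w h
  have hw : w = u - z := mul_left_cancel₀ h0 (by linear_combination h - hu)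
  subst hw
  simp only [IsUnitAvoiding, mem_insert, mem_singleton]
  grind

theorem card_secondRows_generic {x y : F} (hx0 : x ≠ 0) (hx1 : x ≠ 1) (hy0 : y ≠ 0) (hy1 : y ≠ 1)
    (hxy0 : x ≠ y) (hxy1 : x + y ≠ 1) :
    #(secondRows x y) = Fintype.card F - 6 := by
  have h2 : (2 : F) = 0 := CharTwo.two_eq_zero
  have hadd : x + y ≠ 0 := fun h ↦ hxy0 (by linear_combination h - y * h2)
  obtain ⟨u, hu⟩ : ∃ u, y * u = 1 + x := ⟨(1 + x) / y, mul_div_cancel₀ _ hy0⟩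
  obtain ⟨v, hv⟩ : ∃ v, (x + y) * v = 1 + x := ⟨(1 + x) / (x + y), mul_div_cancel₀ _ hadd⟩
  have hcard : #({1, 1 + x, u, u + x, v, v + x} : Finset F) = 6 := by
    have hx : 1 + x ≠ 0 := fun h ↦ hx1 (by linear_combination h - h2)
    have hu1 : u ≠ 1 := fun h ↦ hxy1 (by linear_combination hu - y * h + x * h2)
    have hux : u ≠ 1 + x := fun h ↦ mul_ne_zero (sub_ne_zero.2 hy1) hx
      (by linear_combination hu - y * h)
    have hv1 : v ≠ 1 := fun h ↦ hy1 (by linear_combination hv - (x + y) * h)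
    have hvx : v ≠ 1 + x := fun h ↦ mul_ne_zero (sub_ne_zero.2 hxy1) hx
      (by linear_combination hv - (x + y) * h)
    have hu0 : u ≠ 0 := by
      rintro rfl
      exact hx (by rw [← hu, mul_zero])
    have huv : u ≠ v := by
      rintro rfl
      exact mul_ne_zero hx0 hu0 (by linear_combination hv - hu)
    have huvx : u ≠ v + x := by
      intro h
      have hy : y + 1 ≠ 0 := fun h ↦ hy1 (by linear_combination h - h2)
      have hyx : y + 1 + x ≠ 0 := fun h ↦ hxy1 (by linear_combination h - h2)
      refine mul_ne_zero hx0 (mul_ne_zero hy hyx) ?_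
      linear_combination y * (x + y) * h - (x + y) * hu + y * hv +
        (x ^ 2 * y + x * y ^ 2 + x * y) * h2
    exact card_translates_three hx0 hu1 hux hv1 hvx huv huvx
  rw [card_secondRows_of_ne_zero hx0 {1, 1 + x, u, u + x, v, v + x}, hcard]
  intro z w h
  have hzu : z = u ↔ w = 1 := eq_iff_eq_of_mul_sub_eq hy0 hx0
    (by linear_combination h - hu - x * w * h2)
  have hzux : z = u + x ↔ y + w = 1 := eq_iff_eq_of_mul_sub_eq hy0 hx0
    (by linear_combination h - hu - (x * w + x * y) * h2)
  have hzv : z = v ↔ z + w = 1 := eq_iff_eq_of_mul_sub_eq hadd hx0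
    (by linear_combination h - hv - x * w * h2)
  have hzvx : z = v + x ↔ x + y + z + w = 1 := eq_iff_eq_of_mul_sub_eq hadd hx0
    (by linear_combination h - hv - (x * w + x * (x + y)) * h2)
  have hzx : z = 1 + x ↔ x + z = 1 := eq_iff_eq_of_mul_sub_eq one_ne_zero one_ne_zero
    (by linear_combination -x * h2)
  simp only [IsUnitAvoiding, mem_insert, mem_singleton, hzu, hzux, hzv, hzvx, hzx, h,
    hx1, hy1, hxy1, not_or, ne_eq, not_false_eq_true, true_and, and_assoc]

theorem sum_card_secondRows_zero :
    ∑ y : F, #(secondRows 0 y) = (Fintype.card F - 2) * (Fintype.card F - 4) := by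
  have hempty : secondRows (0 : F) 0 = ∅ := by
    ext p
    simp [mem_secondRows, IsUnitAvoiding]
  rw [← sum_compl_add_sum ({0, 1} : Finset F), sum_pair zero_ne_one, hempty,
    secondRows_eq_empty (by simp : (0 : F) = 1 ∨ (1 : F) = 1 ∨ (0 : F) + 1 = 1), card_empty,
    sum_congr rfl (g := fun _ ↦ Fintype.card F - 4), sum_const, card_compl,
    card_pair zero_ne_one, smul_eq_mul, add_zero, add_zero]
  · intro y hy
    simp only [mem_compl, mem_insert, mem_singleton, not_or] at hy
    exact card_secondRows_zero_left hy.1 hy.2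

theorem sum_card_secondRows_of_ne {x : F} (h0 : x ≠ 0) (h1 : x ≠ 1) (hF : 6 ≤ Fintype.card F) :
    ∑ y : F, #(secondRows x y) = (Fintype.card F - 4) * (Fintype.card F - 4) := by
  have h2 : (2 : F) = 0 := CharTwo.two_eq_zero
  have hx : x ≠ 1 + x := by simp
  have h0x : (0 : F) ≠ 1 + x := by grind
  have hcard : #({0, x, 1, 1 + x} : Finset F) = 4 := by
    rw [card_insert_of_notMem, card_insert_of_notMem, card_insert_of_notMem, card_singleton]
    all_goals simp only [mem_insert, mem_singleton]; grind
  rw [← sum_compl_add_sum ({0, x, 1, 1 + x} : Finset F), sum_insert, sum_insert, sum_insert,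
    sum_singleton, card_secondRows_zero_right h0 h1, card_secondRows_self h0 h1,
    secondRows_eq_empty (by simp : x = 1 ∨ (1 : F) = 1 ∨ x + 1 = 1),
    secondRows_eq_empty (by grind : x = 1 ∨ 1 + x = 1 ∨ x + (1 + x) = 1), card_empty,
    sum_congr rfl (g := fun _ ↦ Fintype.card F - 6), sum_const, card_compl, hcard, smul_eq_mul]
  · obtain ⟨k, hk⟩ := Nat.exists_eq_add_of_le hF
    rw [hk, show 6 + k - 4 = k + 2 by omega, show 6 + k - 6 = k by omega]
    ring
  · intro y hy
    simp only [mem_compl, mem_insert, mem_singleton, not_or] at hy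
    exact card_secondRows_generic h0 h1 (by grind) (by grind) (by grind) (by grind)
  all_goals simp only [mem_insert, mem_singleton]; grind

theorem sum_card_secondRows (hF : 6 ≤ Fintype.card F) :
    ∑ x : F, ∑ y : F, #(secondRows x y) =
      (Fintype.card F - 2) * (Fintype.card F - 3) * (Fintype.card F - 4) := by
  rw [← sum_compl_add_sum ({0, 1} : Finset F), sum_pair zero_ne_one, sum_card_secondRows_zero,
    sum_congr rfl (g := fun _ ↦ (Fintype.card F - 4) * (Fintype.card F - 4)), sum_const,
    card_compl, card_pair zero_ne_one, smul_eq_mul,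
    sum_eq_zero fun y _ ↦ by rw [secondRows_eq_empty (Or.inl rfl), card_empty]]
  · obtain ⟨k, hk⟩ := Nat.exists_eq_add_of_le hF
    rw [hk, show 6 + k - 4 = k + 2 by omega, show 6 + k - 3 = k + 3 by omega]
    ring
  · intro x hx
    simp only [mem_compl, mem_insert, mem_singleton, not_or] at hx
    exact sum_card_secondRows_of_ne hx.1 hx.2 hF

end

/-- Enumeration of the free parameters of `3×3` orthogonal MDS matrices over `F_{2^m}`. -/
theorem stmt_15 {F : Type*} [Field F] [Fintype F] [CharP F 2]
    (m : ℕ) (hm : 3 ≤ m) (hcard : Fintype.card F = 2 ^ m) :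
    Nat.card {p : F × F × F × F //
        p.1 * p.2.2.2 + p.2.1 * p.2.2.1 + p.1 + p.2.1 + p.2.2.1 + p.2.2.2 = 1 ∧
        p.1 ≠ 0 ∧ p.2.1 ≠ 0 ∧ p.2.2.1 ≠ 0 ∧ p.2.2.2 ≠ 0 ∧
        p.2.1 ≠ p.1 + 1 ∧ p.2.2.1 ≠ p.1 + 1 ∧
        p.2.2.2 ≠ p.2.1 + 1 ∧ p.2.2.2 ≠ p.2.2.1 + 1 ∧
        p.2.2.2 ≠ p.1 + p.2.1 + p.2.2.1 + 1} =
      (2 ^ m - 2) * (2 ^ m - 3) * (2 ^ m - 4) := by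
  classical
  have hF : 6 ≤ Fintype.card F := by
    rw [hcard]
    exact le_trans (by norm_num) (Nat.pow_le_pow_right two_pos hm)
  rw [← hcard, ← sum_card_secondRows hF, ← Fintype.sum_prod_type', ← card_sigma,
    Nat.card_eq_fintype_card, Fintype.card_subtype]
  refine card_nbij' (fun p ↦ ⟨(p.1 + 1, p.2.1 + 1), (p.2.2.1 + 1, p.2.2.2 + 1)⟩)
    (fun q ↦ (q.1.1 + 1, q.1.2 + 1, q.2.1 + 1, q.2.2 + 1)) ?_ ?_ ?_ ?_
  · rintro ⟨a, b, c, d⟩ h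
    simp only [coe_filter, mem_univ, true_and, Set.mem_ofPred_eq] at h
    simp only [coe_sigma, Set.mem_sigma_iff, mem_coe, mem_univ, true_and, mem_secondRows]
    exact (isUnitAvoiding_add_one a b c d).2 h
  · rintro ⟨⟨x, y⟩, z, w⟩ h
    simp only [coe_sigma, Set.mem_sigma_iff, mem_coe, mem_univ, true_and, mem_secondRows] at h
    simp only [coe_filter, mem_univ, true_and, Set.mem_ofPred_eq]
    rw [← isUnitAvoiding_add_one]
    simpa [add_assoc, CharTwo.add_self_eq_zero] using h
  · rintro ⟨a, b, c, d⟩ _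
    simp [add_assoc, CharTwo.add_self_eq_zero]
  · rintro ⟨⟨x, y⟩, z, w⟩ _
    simp [add_assoc, CharTwo.add_self_eq_zero]
end
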